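/- arXiv:1508.02199 — 4 statements merged into one kernel-verified Lean document; each statement's English description precedes it below -/
import Mathlib

section
/- Let α, β, γ be types, let n be a natural number, let R : α → β → Prop be a stable relation, and let θ : γ → α → Prop be a relation such that for every v : γ the set {x : α | θ v x} is finite with at most n elements. Then the relation S : γ → β → Prop defined by S v y ↔ ∃ x, θ v x ∧ R x y is stable. (This is Lemma 2 of the paper: a stable formula remains stable after algebraically bounded existential quantification.) -/
/-- Lemma 2: a stable relation remains stable after algebraically bounded
existential quantification. A relation `R` is *stable* if there are no
sequences `a`, `b` with `R (a i) (b j) ↔ i < j`. -/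
theorem stable_of_bounded_exists {α β γ : Type*} (n : ℕ)
    (R : α → β → Prop)
    (hR : ¬ ∃ (a : ℕ → α) (b : ℕ → β), ∀ i j : ℕ, R (a i) (b j) ↔ i < j)
    (θ : γ → α → Prop)
    (hθ : ∀ v : γ, {x : α | θ v x}.Finite ∧ {x : α | θ v x}.ncard ≤ n) :
    ¬ ∃ (a : ℕ → γ) (b : ℕ → β),
      ∀ i j : ℕ, (∃ x : α, θ (a i) x ∧ R x (b j)) ↔ i < j := by
  rintro ⟨a, b, hab⟩
  apply hR
  -- A nonprincipal ultrafilter picks, for each `i`, one witness that works for almost all `j`.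
  have key : ∀ i : ℕ, ∃ x : α, θ (a i) x ∧
      ∀ᶠ j in (Filter.hyperfilter ℕ : Filter ℕ), R x (b j) := by
    intro i
    have h1 : ∀ᶠ j in (Filter.hyperfilter ℕ : Filter ℕ), i < j :=
      Nat.hyperfilter_le_atTop (Filter.eventually_gt_atTop i)
    have h2 : (⋃ x ∈ {x : α | θ (a i) x}, {j : ℕ | R x (b j)}) ∈ Filter.hyperfilter ℕ := by
      refine Filter.mem_of_superset h1 ?_
      intro j hj
      obtain ⟨x, hx, hr⟩ := (hab i j).2 hj
      exact Set.mem_biUnion (x := x) hx hr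
    obtain ⟨x, hx, hr⟩ := (Ultrafilter.finite_biUnion_mem_iff (hθ (a i)).1).1 h2
    exact ⟨x, hx, hr⟩
  choose x hx hr using key
  obtain ⟨f, -, hf⟩ := exists_seq_of_forall_finset_exists (fun _ : ℕ => True)
    (fun i j => i < j ∧ R (x i) (b j)) (by
      intro s _
      have h : ∀ᶠ j in (Filter.hyperfilter ℕ : Filter ℕ), ∀ i ∈ s, i < j ∧ R (x i) (b j) := by
        rw [Filter.eventually_all_finset]
        intro i _
        exact ((Filter.eventually_gt_atTop i).filter_mono Nat.hyperfilter_le_atTop).and (hr i)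
      obtain ⟨j, hj⟩ := h.exists
      exact ⟨j, trivial, hj⟩)
  have hmono : StrictMono f := fun i j hij => (hf i j hij).1
  refine ⟨fun i => x (f i), fun j => b (f j), fun i j => ⟨fun h => ?_, fun h => (hf i j h).2⟩⟩
  exact hmono.lt_iff_lt.1 ((hab (f i) (f j)).1 ⟨x (f i), hx _, h⟩)
end

section
/- Let γ, δ, β be types and let n, k be natural numbers with k ≥ 1. Let θ : γ → δ → Prop be a relation such that for every v : γ the set {w : δ | θ v w} is finite with at most n elements, let χ : δ → β → Prop be a relation, and let b : ℕ → β be a sequence. Suppose the family {χ(·, b i) : i ∈ ℕ} is k-inconsistent, i.e. for every finite set s ⊆ ℕ with |s| = k there is no w : δ satisfying χ w (b i) for all i ∈ s. Then the family {v ↦ ∃ w, θ v w ∧ χ w (b i) : i ∈ ℕ} is (n·(k-1)+1)-inconsistent, i.e. for every finite set s ⊆ ℕ with |s| = n·(k-1)+1 there is no v : γ such that for every i ∈ s there exists w with θ v w ∧ χ w (b i). (This is Claim 2 in the proof of Proposition 4 of the paper.) -/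
/-- Claim 2 in the proof of Proposition 4: if the family `χ (·, b i)` is
`k`-inconsistent and `θ v ·` always has at most `n` solutions, then the family
`fun v => ∃ w, θ v w ∧ χ w (b i)` is `(n*(k-1)+1)`-inconsistent. -/
theorem inconsistency_of_bounded_exists {γ δ β : Type*} (n k : ℕ) (hk : 1 ≤ k)
    (θ : γ → δ → Prop)
    (hθ : ∀ v : γ, {w : δ | θ v w}.Finite ∧ {w : δ | θ v w}.ncard ≤ n)
    (χ : δ → β → Prop) (b : ℕ → β)
    (hχ : ∀ s : Finset ℕ, s.card = k → ¬ ∃ w : δ, ∀ i ∈ s, χ w (b i)) :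
    ∀ s : Finset ℕ, s.card = n * (k - 1) + 1 →
      ¬ ∃ v : γ, ∀ i ∈ s, ∃ w : δ, θ v w ∧ χ w (b i) := by
  classical
  rintro s hs ⟨v, hv⟩
  obtain ⟨hfin, hcard⟩ := hθ v
  rw [Set.ncard_eq_toFinset_card _ hfin] at hcard
  have hsub : s ⊆ hfin.toFinset.biUnion (fun w => s.filter (fun i => χ w (b i))) := by
    intro i hi
    obtain ⟨w, hw, hc⟩ := hv i hi
    simp only [Finset.mem_biUnion, Finset.mem_filter, Set.Finite.mem_toFinset, Set.mem_setOf_eq]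
    exact ⟨w, hw, hi, hc⟩
  have h1 := Finset.card_le_card hsub
  have h2 := Finset.card_biUnion_le_card_mul hfin.toFinset
    (fun w => s.filter (fun i => χ w (b i))) (k - 1) (by
      intro w _
      by_contra hlt
      obtain ⟨t, ht, htk⟩ := Finset.exists_subset_card_eq
        (show k ≤ (s.filter (fun i => χ w (b i))).card by omega)
      exact hχ t htk ⟨w, fun i hi => (Finset.mem_filter.mp (ht hi)).2⟩)
  have h3 := Nat.mul_le_mul_right (k - 1) hcard
  omega
end

section
/- Let α, β be types and let R₁, R₂ : α → β → Prop be stable relations. Then the disjunction (fun x y => R₁ x y ∨ R₂ x y) is stable. (Part of Remark 1(1) of the paper: boolean combinations of stable formulas are stable.) -/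
theorem seq_of_freq (P : ℕ → ℕ → Prop)
    (h : ∀ᶠ i in (Filter.hyperfilter ℕ : Filter ℕ),
      ∀ᶠ j in (Filter.hyperfilter ℕ : Filter ℕ), P i j) :
    ∃ f : ℕ → ℕ, ∀ m n, m < n → f m < f n ∧ P (f m) (f n) := by
  obtain ⟨f, -, hf⟩ := exists_seq_of_forall_finset_exists
    (fun i => ∀ᶠ j in (Filter.hyperfilter ℕ : Filter ℕ), P i j)
    (fun x y => x < y ∧ P x y) (by
      intro s hs
      have h2 : ∀ᶠ y in (Filter.hyperfilter ℕ : Filter ℕ), ∀ x ∈ s, x < y ∧ P x y := by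
        rw [Filter.eventually_all_finset]
        intro x hx
        have h3 : ∀ᶠ y in (Filter.hyperfilter ℕ : Filter ℕ), x < y :=
          Nat.hyperfilter_le_atTop (Filter.eventually_gt_atTop x)
        exact h3.and (hs x hx)
      exact (h.and h2).exists)
  exact ⟨f, hf⟩

theorem order_of_seq {α β : Type*} (R S : α → β → Prop) (a : ℕ → α) (b : ℕ → β)
    (hS : ∀ i j, S (a i) (b j) → i < j)
    (hRS : ∀ x y, R x y → S x y)
    (h : ∀ᶠ i in (Filter.hyperfilter ℕ : Filter ℕ),
      ∀ᶠ j in (Filter.hyperfilter ℕ : Filter ℕ), R (a i) (b j)) :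
    ∃ (a : ℕ → α) (b : ℕ → β), ∀ i j : ℕ, R (a i) (b j) ↔ i < j := by
  obtain ⟨f, hf⟩ := seq_of_freq (fun i j => R (a i) (b j)) h
  have hm : StrictMono f := fun m n hmn => (hf m n hmn).1
  exact ⟨a ∘ f, b ∘ f, fun i j =>
    ⟨fun hr => hm.lt_iff_lt.1 (hS _ _ (hRS _ _ hr)), fun hij => (hf i j hij).2⟩⟩

/-- The disjunction of two stable relations is stable. A relation `R` is
*stable* if there are no sequences `a`, `b` with `R (a i) (b j) ↔ i < j`. -/
theorem stable_or {α β : Type*} (R₁ R₂ : α → β → Prop)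
    (hR₁ : ¬ ∃ (a : ℕ → α) (b : ℕ → β), ∀ i j : ℕ, R₁ (a i) (b j) ↔ i < j)
    (hR₂ : ¬ ∃ (a : ℕ → α) (b : ℕ → β), ∀ i j : ℕ, R₂ (a i) (b j) ↔ i < j) :
    ¬ ∃ (a : ℕ → α) (b : ℕ → β),
      ∀ i j : ℕ, (R₁ (a i) (b j) ∨ R₂ (a i) (b j)) ↔ i < j := by
  rintro ⟨a, b, h⟩
  have key : ∀ᶠ i in (Filter.hyperfilter ℕ : Filter ℕ),
      (∀ᶠ j in (Filter.hyperfilter ℕ : Filter ℕ), R₁ (a i) (b j)) ∨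
      (∀ᶠ j in (Filter.hyperfilter ℕ : Filter ℕ), R₂ (a i) (b j)) := by
    refine Filter.Eventually.of_forall fun i => ?_
    rw [← Ultrafilter.eventually_or]
    have h3 : ∀ᶠ y in (Filter.hyperfilter ℕ : Filter ℕ), i < y :=
      Nat.hyperfilter_le_atTop (Filter.eventually_gt_atTop i)
    exact h3.mono fun j hj => (h i j).2 hj
  rw [Ultrafilter.eventually_or] at key
  rcases key with k | k
  · exact hR₁ (order_of_seq R₁ (fun x y => R₁ x y ∨ R₂ x y) a b
      (fun i j => (h i j).1) (fun _ _ => Or.inl) k)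
  · exact hR₂ (order_of_seq R₂ (fun x y => R₁ x y ∨ R₂ x y) a b
      (fun i j => (h i j).1) (fun _ _ => Or.inr) k)
end

section
/- Let M be the type {p : ℕ × ℕ // p.1 ≤ p.2}, and define relations E, F : M → M → Prop by E x y ↔ x.val.1 = y.val.1 and F x y ↔ x.val.2 = y.val.2. Then E and F are equivalence relations (hence stable relations), but the composed relation S : M → M → Prop defined by S x z ↔ ∃ y : M, E x y ∧ F y z has the order property. (This is the example of Section 3 of the paper showing that Lemma 2 fails when the algebraicity/finiteness hypothesis on θ is dropped: the composition of two stable relations along an existential quantifier can be unstable.) -/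
/-- The example of Section 3: on `M = {p : ℕ × ℕ // p.1 ≤ p.2}`, the relations
`E x y ↔ x.val.1 = y.val.1` and `F x y ↔ x.val.2 = y.val.2` are equivalence
relations (hence stable), but the composed relation
`S x z ↔ ∃ y, E x y ∧ F y z` has the order property. -/
theorem composition_of_stable_unstable :
    Equivalence (fun x y : {p : ℕ × ℕ // p.1 ≤ p.2} => x.val.1 = y.val.1) ∧
    Equivalence (fun x y : {p : ℕ × ℕ // p.1 ≤ p.2} => x.val.2 = y.val.2) ∧
    ∃ (a b : ℕ → {p : ℕ × ℕ // p.1 ≤ p.2}),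
      ∀ i j : ℕ,
        (∃ y : {p : ℕ × ℕ // p.1 ≤ p.2},
          (a i).val.1 = y.val.1 ∧ y.val.2 = (b j).val.2) ↔ i < j := by
  refine ⟨⟨fun _ => rfl, fun h => h.symm, fun h k => h.trans k⟩,
    ⟨fun _ => rfl, fun h => h.symm, fun h k => h.trans k⟩,
    fun i => ⟨(i + 1, i + 1), le_rfl⟩, fun j => ⟨(0, j), Nat.zero_le j⟩, fun i j => ⟨?_, ?_⟩⟩
  · rintro ⟨⟨⟨p, q⟩, hpq⟩, h1, h2⟩
    simp only at hpq h1 h2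
    omega
  · intro h
    exact ⟨⟨(i + 1, j), h⟩, rfl, rfl⟩
end
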